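/- Let a be a coefficient family that is τ-invariant and at most 1-singular on W, where W is admissible, and let F : ℂ × (Fin d → ℂ) → ℂ be analytic on W with F ∘ τ = F on W. Then the function (a · F)(z₁, z′) = Σ_{(m,μ)} a_{(m,μ)}(z₁, z′) · F(z₁ − m, z′ − μ), defined on {(z₁, z′) ∈ W : z₁ ≠ 0}, extends to a function analytic at v. -/

import Mathlib

open Topology Filter

noncomputable section

/-- The involution `τ (z₁, z′) = (-z₁, z′)` on `ℂ × (Fin d → ℂ)`. -/
def tauMap (d : ℕ) : ℂ × (Fin d → ℂ) → ℂ × (Fin d → ℂ) := fun p => (-p.1, p.2)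

/-- Translation of a point: `(z₁, z′) ↦ (z₁ - m, z′ - μ)`. -/
def shiftPt (d : ℕ) (σ : ℤ × (Fin d → ℤ)) (p : ℂ × (Fin d → ℂ)) :
    ℂ × (Fin d → ℂ) :=
  (p.1 - (σ.1 : ℂ), fun i => p.2 i - (σ.2 i : ℂ))

/-- A coefficient family. -/
abbrev Fam (d : ℕ) := (ℤ × (Fin d → ℤ)) → ℂ × (Fin d → ℂ) → ℂ

/-- The family is finitely supported. -/
def FinSuppFam (d : ℕ) (a : Fam d) : Prop := (Function.support a).Finite

/-- `τ`-invariance of a family: `a_{(-m,μ)} (z₁, z′) = a_{(m,μ)} (-z₁, z′)`. -/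
def TauInvFam (d : ℕ) (a : Fam d) : Prop :=
  ∀ (m : ℤ) (μ : Fin d → ℤ) (p : ℂ × (Fin d → ℂ)),
    a (-m, μ) p = a (m, μ) (tauMap d p)

/-- The family `a` is at most `1`-singular on `W`. -/
def OneSingOn (d : ℕ) (W : Set (ℂ × (Fin d → ℂ))) (a : Fam d) : Prop :=
  ∀ σ : ℤ × (Fin d → ℤ), ∃ g : ℂ × (Fin d → ℂ) → ℂ, AnalyticOnNhd ℂ g W ∧
    ∀ p ∈ W, p.1 ≠ 0 → a σ p = g p / p.1

/-- `W` is admissible: open, contains `v = (0, w₀)`, and invariant under `τ`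
and under all integer translations. -/
def Admissible (d : ℕ) (w₀ : Fin d → ℂ) (W : Set (ℂ × (Fin d → ℂ))) : Prop :=
  IsOpen W ∧ ((0 : ℂ), w₀) ∈ W ∧ (∀ p ∈ W, tauMap d p ∈ W) ∧
    ∀ (σ : ℤ × (Fin d → ℤ)), ∀ p ∈ W, shiftPt d σ p ∈ W

/-- Action of a coefficient family on a function:
`(a · F) (z₁, z′) = Σ_{(m,μ)} a_{(m,μ)} (z₁, z′) · F (z₁ - m, z′ - μ)`. -/
def actFam (d : ℕ) (a : Fam d) (F : ℂ × (Fin d → ℂ) → ℂ) :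
    ℂ × (Fin d → ℂ) → ℂ :=
  fun p => ∑ᶠ σ : ℤ × (Fin d → ℤ), a σ p * F (shiftPt d σ p)

/-- The projection `(t, e) ↦ (0, e)`. -/
def projSnd (𝕜 E : Type*) [NontriviallyNormedField 𝕜] [NormedAddCommGroup E]
    [NormedSpace 𝕜 E] : 𝕜 × E →L[𝕜] 𝕜 × E :=
  (ContinuousLinearMap.inr 𝕜 𝕜 E).comp (ContinuousLinearMap.snd 𝕜 𝕜 E)

section Division

variable {𝕜 E G : Type*} [NontriviallyNormedField 𝕜] [NormedAddCommGroup E]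
  [NormedSpace 𝕜 E] [NormedAddCommGroup G] [NormedSpace 𝕜 G]

@[simp] lemma projSnd_apply (y : 𝕜 × E) : projSnd 𝕜 E y = (0, y.2) := rfl

lemma norm_projSnd_apply_le (y : 𝕜 × E) : ‖projSnd 𝕜 E y‖ ≤ ‖y‖ := by
  simp [Prod.norm_def]

/-- The power series of `(f (t, e) - f (0, e)) / t`, obtained from the power series of `f` by
telescoping. -/
def divFstSeries (p : FormalMultilinearSeries 𝕜 (𝕜 × E) G) :
    FormalMultilinearSeries 𝕜 (𝕜 × E) G := fun n =>
  ∑ k : Fin (n + 1), ((p (n + 1)).curryMid k ((1 : 𝕜), (0 : E))).compContinuousLinearMap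
    (fun i => if i.castSucc < k then ContinuousLinearMap.id 𝕜 (𝕜 × E) else projSnd 𝕜 E)

lemma norm_divFstSeries_le (p : FormalMultilinearSeries 𝕜 (𝕜 × E) G) (n : ℕ) :
    ‖divFstSeries p n‖ ≤ (n + 1) * ‖p (n + 1)‖ := by
  have hterm : ∀ k : Fin (n + 1),
      ‖((p (n + 1)).curryMid k ((1 : 𝕜), (0 : E))).compContinuousLinearMap
        (fun i => if i.castSucc < k then ContinuousLinearMap.id 𝕜 (𝕜 × E)
          else projSnd 𝕜 E)‖ ≤ ‖p (n + 1)‖ := by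
    intro k
    refine (ContinuousMultilinearMap.norm_compContinuousLinearMap_le _ _).trans ?_
    have h1 : ‖(p (n + 1)).curryMid k ((1 : 𝕜), (0 : E))‖ ≤ ‖p (n + 1)‖ := by
      refine (((p (n + 1)).curryMid k).le_opNorm _).trans ?_
      rw [ContinuousMultilinearMap.norm_curryMid]
      simp [Prod.norm_def]
    have h2 : ∏ i : Fin n, ‖if i.castSucc < k then ContinuousLinearMap.id 𝕜 (𝕜 × E)
        else projSnd 𝕜 E‖ ≤ 1 := by
      refine Finset.prod_le_one (fun _ _ => norm_nonneg _) fun i _ => ?_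
      split_ifs
      · exact ContinuousLinearMap.norm_id_le
      · exact ContinuousLinearMap.opNorm_le_bound _ zero_le_one fun y => by
          simpa only [one_mul] using norm_projSnd_apply_le y
    exact (mul_le_mul h1 h2 (Finset.prod_nonneg fun _ _ => norm_nonneg _)
      (norm_nonneg _)).trans_eq (mul_one _)
  refine (norm_sum_le_of_le _ fun k _ => hterm k).trans_eq ?_
  simp

lemma fst_smul_divFstSeries (p : FormalMultilinearSeries 𝕜 (𝕜 × E) G) (n : ℕ) (y : 𝕜 × E) :
    y.1 • divFstSeries p n (fun _ => y) =
      p (n + 1) (fun _ => y) - p (n + 1) (fun _ => projSnd 𝕜 E y) := by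
  let u : ℕ → G := fun k => p (n + 1) fun i => if (i : ℕ) < k then y else projSnd 𝕜 E y
  have hy : y - projSnd 𝕜 E y = y.1 • ((1 : 𝕜), (0 : E)) := by
    ext <;> simp
  have hterm : ∀ k : Fin (n + 1), y.1 •
      ((p (n + 1)).curryMid k ((1 : 𝕜), (0 : E))).compContinuousLinearMap
        (fun i => if i.castSucc < k then ContinuousLinearMap.id 𝕜 (𝕜 × E)
          else projSnd 𝕜 E) (fun _ => y) = u (k + 1) - u k := by
    intro k
    let m : Fin n → 𝕜 × E := fun i => if i.castSucc < k then y else projSnd 𝕜 E y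
    have hins : ∀ x : 𝕜 × E, k.insertNth (α := fun _ => 𝕜 × E) x m =
        Function.update (k.insertNth (α := fun _ => 𝕜 × E) 0 m) k x := fun x => by simp
    have hcases : ∀ (x : 𝕜 × E) (c : ℕ), (x = if (k : ℕ) < c then y else projSnd 𝕜 E y) →
        (c = k ∨ c = k + 1) → k.insertNth (α := fun _ => 𝕜 × E) x m =
          fun i : Fin (n + 1) => if (i : ℕ) < c then y else projSnd 𝕜 E y := by
      intro x c hx hc
      rw [Fin.insertNth_eq_iff]
      refine ⟨hx, funext fun i => ?_⟩
      simp only [m, Fin.removeNth]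
      refine if_congr ?_ rfl rfl
      rcases lt_or_ge i.castSucc k with h | h
      · rw [Fin.succAbove_of_castSucc_lt _ _ h]
        simp only [Fin.lt_def, Fin.val_castSucc] at h ⊢
        omega
      · rw [Fin.succAbove_of_le_castSucc _ _ h]
        simp only [Fin.le_def, Fin.lt_def, Fin.val_castSucc, Fin.val_succ] at h ⊢
        omega
    have hm : (fun i : Fin n => (if i.castSucc < k then ContinuousLinearMap.id 𝕜 (𝕜 × E)
          else projSnd 𝕜 E) y) = m := by
      funext i
      simp only [m]
      split_ifs <;> rfl
    rw [ContinuousMultilinearMap.compContinuousLinearMap_apply, hm,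
      ContinuousMultilinearMap.curryMid_apply, hins,
      ← ContinuousMultilinearMap.map_update_smul, ← hy,
      ContinuousMultilinearMap.map_update_sub, ← hins, ← hins,
      hcases y (k + 1) (by simp) (Or.inr rfl), hcases (projSnd 𝕜 E y) k (by simp) (Or.inl rfl)]
  have hsum : y.1 • divFstSeries p n (fun _ => y) = ∑ k : Fin (n + 1), (u (k + 1) - u k) := by
    rw [divFstSeries, sum_apply, Finset.smul_sum]
    exact Finset.sum_congr rfl fun k _ => hterm k
  rw [hsum, Fin.sum_univ_eq_sum_range (fun k => u (k + 1) - u k), Finset.sum_range_sub]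
  have hlast : u (n + 1) = p (n + 1) fun _ => y := by
    simp only [u, Fin.is_lt, if_true]
  rw [hlast]
  simp [u]

lemma divFstSeries_radius_pos (p : FormalMultilinearSeries 𝕜 (𝕜 × E) G) (hp : 0 < p.radius) :
    0 < (divFstSeries p).radius := by
  obtain ⟨r, hr0, hr⟩ := ENNReal.lt_iff_exists_nnreal_btwn.1 hp
  have hr0' : 0 < r := by exact_mod_cast hr0
  obtain ⟨C, -, hC⟩ := p.norm_mul_pow_le_of_lt_radius hr
  refine lt_of_lt_of_le (b := ((r / 2 : NNReal) : ENNReal)) (by positivity)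
    ((divFstSeries p).le_radius_of_bound (C / r) fun n => ?_)
  have hrr : (0 : ℝ) < r := hr0'
  have htwo : ((n : ℝ) + 1) ≤ 2 ^ n := by exact_mod_cast Nat.lt_two_pow_self (n := n)
  rw [le_div_iff₀ hrr]
  calc ‖divFstSeries p n‖ * ((r / 2 : NNReal) : ℝ) ^ n * r
      ≤ (2 ^ n * ‖p (n + 1)‖) * ((r / 2 : NNReal) : ℝ) ^ n * r := by
        gcongr
        exact (norm_divFstSeries_le p n).trans (by gcongr)
    _ = ‖p (n + 1)‖ * (r : ℝ) ^ (n + 1) := by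
        push_cast
        rw [div_pow]
        field_simp
        ring
    _ ≤ C := hC (n + 1)

/-- An analytic function `f` on a product satisfies `f (t, e) - f (0, e) = t • g (t, e)` near
`(0, w)` with `g` analytic. -/
lemma AnalyticAt.exists_sub_eq_fst_smul [CompleteSpace G] {f : 𝕜 × E → G} {w : E}
    (hf : AnalyticAt 𝕜 f (0, w)) :
    ∃ g : 𝕜 × E → G, AnalyticAt 𝕜 g (0, w) ∧
      ∀ᶠ x in 𝓝 ((0 : 𝕜), w), f x - f (0, x.2) = x.1 • g x := by
  obtain ⟨p, r, hp⟩ := hf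
  have hq := (divFstSeries p).hasFPowerSeriesOnBall (divFstSeries_radius_pos p hp.radius_pos)
  have hg := hq.comp_sub ((0 : 𝕜), w)
  rw [zero_add] at hg
  refine ⟨_, hg.analyticAt, ?_⟩
  filter_upwards [Metric.eball_mem_nhds ((0 : 𝕜), w) hp.r_pos,
    Metric.eball_mem_nhds ((0 : 𝕜), w) hg.r_pos] with x hx hx'
  set y := x - ((0 : 𝕜), w) with hy
  have hxy : ((0 : 𝕜), w) + y = x := by simp [hy]
  have hyr : y ∈ Metric.eball (0 : 𝕜 × E) r := by
    simpa [hy, edist_eq_enorm_sub] using hx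
  have hyq : y ∈ Metric.eball (0 : 𝕜 × E) (divFstSeries p).radius := by
    simpa [hy, edist_eq_enorm_sub] using hx'
  have hPy : projSnd 𝕜 E y ∈ Metric.eball (0 : 𝕜 × E) r := by
    rw [Metric.mem_eball, edist_zero_right] at hyr ⊢
    exact lt_of_le_of_lt (enorm_le_iff_norm_le.2 (norm_projSnd_apply_le y)) hyr
  have h1 := (hp.hasSum hyr).sub (hp.hasSum hPy)
  have h2 := (hq.hasSum hyq).const_smul y.1
  have hP : ((0 : 𝕜), w) + projSnd 𝕜 E y = (0, x.2) := by
    ext <;> simp [hy]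
  rw [hxy, hP, ← hasSum_nat_add_iff' 1] at h1
  simp only [fst_smul_divFstSeries, zero_add] at h2
  have h0 : (fun _ => y : Fin 0 → 𝕜 × E) = fun _ => projSnd 𝕜 E y := Subsingleton.elim _ _
  rw [Finset.sum_range_one, h0, sub_self, sub_zero] at h1
  have := h1.unique h2
  simpa [hy] using this

end Division

lemma tauMap_tauMap (d : ℕ) (p : ℂ × (Fin d → ℂ)) : tauMap d (tauMap d p) = p := by
  simp [tauMap]

lemma analyticAt_shiftPt (d : ℕ) (σ : ℤ × (Fin d → ℤ)) (p : ℂ × (Fin d → ℂ)) :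
    AnalyticAt ℂ (shiftPt d σ) p := by
  have h : shiftPt d σ = fun p => p - ((σ.1 : ℂ), fun i => (σ.2 i : ℂ)) := rfl
  rw [h]
  exact analyticAt_id.sub analyticAt_const

/-- The action preserves `τ`-invariance. -/
lemma actFam_tauMap (d : ℕ) {W : Set (ℂ × (Fin d → ℂ))} {a : Fam d} (htau : TauInvFam d a)
    {F : ℂ × (Fin d → ℂ) → ℂ} (hFtau : ∀ p ∈ W, F (tauMap d p) = F p)
    (hW : ∀ (σ : ℤ × (Fin d → ℤ)), ∀ p ∈ W, shiftPt d σ p ∈ W)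
    {p : ℂ × (Fin d → ℂ)} (hp : p ∈ W) :
    actFam d a F (tauMap d p) = actFam d a F p := by
  let e : ℤ × (Fin d → ℤ) ≃ ℤ × (Fin d → ℤ) := (Equiv.neg ℤ).prodCongr (Equiv.refl _)
  unfold actFam
  rw [← finsum_comp_equiv e]
  refine finsum_congr fun ⟨m, μ⟩ => ?_
  have hs : shiftPt d (-m, μ) (tauMap d p) = tauMap d (shiftPt d (m, μ) p) := by
    ext
    · simp [shiftPt, tauMap]
      ring
    · simp [shiftPt, tauMap]
  change a (-m, μ) (tauMap d p) * F (shiftPt d (-m, μ) (tauMap d p)) = _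
  rw [htau, tauMap_tauMap, hs, hFtau _ (hW _ _ hp)]

/-- **Remark after Proposition 3.1 of the paper.**  If `a` is a `τ`-invariant
coefficient family at most `1`-singular on an admissible `W`, and `F` is
analytic on `W` with `F ∘ τ = F` on `W`, then `a · F` (defined off `z₁ = 0`)
extends to a function analytic at `v = (0, w₀)`. -/
theorem act_extends_analytic (d : ℕ) (w₀ : Fin d → ℂ)
    (W : Set (ℂ × (Fin d → ℂ))) (hW : Admissible d w₀ W)
    (a : Fam d) (hfin : FinSuppFam d a) (htau : TauInvFam d a)
    (hsing : OneSingOn d W a)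
    (F : ℂ × (Fin d → ℂ) → ℂ) (hF : AnalyticOnNhd ℂ F W)
    (hFtau : ∀ p ∈ W, F (tauMap d p) = F p) :
    ∃ G : ℂ × (Fin d → ℂ) → ℂ, AnalyticAt ℂ G ((0 : ℂ), w₀) ∧
      ∀ᶠ p : ℂ × (Fin d → ℂ) in 𝓝 ((0 : ℂ), w₀),
        p.1 ≠ 0 → actFam d a F p = G p := by
  obtain ⟨hWopen, hv, hWtau, hWshift⟩ := hW
  choose g hg hag using hsing
  let H : ℂ × (Fin d → ℂ) → ℂ := fun p => ∑ σ ∈ hfin.toFinset, g σ p * F (shiftPt d σ p)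
  have hH : AnalyticOnNhd ℂ H W := fun p hp =>
    Finset.analyticAt_fun_sum _ fun σ _ =>
      (hg σ p hp).mul ((hF _ (hWshift σ p hp)).comp (analyticAt_shiftPt d σ p))
  have hact : ∀ p ∈ W, p.1 ≠ 0 → actFam d a F p = H p / p.1 := by
    intro p hp hp1
    have hsupp : (Function.support fun σ => a σ p * F (shiftPt d σ p)) ⊆ hfin.toFinset := by
      intro σ hσ
      exact hfin.mem_toFinset.2 fun h => hσ (by simp [h])
    rw [actFam, finsum_eq_sum_of_support_subset _ hsupp, Finset.sum_div]
    refine Finset.sum_congr rfl fun σ _ => ?_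
    rw [hag σ p hp hp1, div_mul_eq_mul_div]
  have hodd : ∀ p ∈ W, p.1 ≠ 0 → H (tauMap d p) + H p = 0 := by
    intro p hp hp1
    have h := actFam_tauMap d htau hFtau hWshift hp
    have hp1' : (tauMap d p).1 ≠ 0 := neg_ne_zero.2 hp1
    rw [hact p hp hp1, hact _ (hWtau p hp) hp1', div_eq_div_iff hp1' hp1] at h
    change H (tauMap d p) * p.1 = H p * -p.1 at h
    exact mul_right_cancel₀ hp1 (by linear_combination h)
  have hzero : ∀ z, ((0 : ℂ), z) ∈ W → H (0, z) = 0 := by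
    intro z hz
    have hc : ContinuousAt (fun t : ℂ => (t, z)) 0 := by fun_prop
    have hc' : ContinuousAt (fun t : ℂ => (-t, z)) 0 := by fun_prop
    have hHc : ContinuousAt H (0, z) := (hH _ hz).continuousAt
    have hlim : ContinuousAt (fun t : ℂ => H (-t, z) + H (t, z)) 0 :=
      (ContinuousAt.comp (g := H) (f := fun t : ℂ => (-t, z)) (by simpa using hHc) hc').add
        (ContinuousAt.comp (g := H) (f := fun t : ℂ => (t, z)) hHc hc)
    have hev : ∀ᶠ t in 𝓝[≠] (0 : ℂ), H (-t, z) + H (t, z) = 0 := by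
      filter_upwards [(hc.eventually (hWopen.mem_nhds hz)).filter_mono nhdsWithin_le_nhds,
        self_mem_nhdsWithin] with t ht ht0
      exact hodd (t, z) ht ht0
    have h := tendsto_nhds_unique (hlim.tendsto.mono_left nhdsWithin_le_nhds)
      (tendsto_const_nhds.congr' (hev.mono fun t ht => ht.symm))
    rw [neg_zero] at h
    exact self_eq_neg.1 (eq_neg_of_add_eq_zero_left h)
  obtain ⟨G, hG, hGeq⟩ := (hH _ hv).exists_sub_eq_fst_smul
  have hproj : ContinuousAt (fun p : ℂ × (Fin d → ℂ) => ((0 : ℂ), p.2)) (0, w₀) := by fun_prop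
  refine ⟨G, hG, ?_⟩
  filter_upwards [hGeq, hWopen.mem_nhds hv, hproj.eventually (hWopen.mem_nhds hv)]
    with p hp hpW hpW0 hp1
  rw [hzero _ hpW0, sub_zero, smul_eq_mul] at hp
  rw [hact p hpW hp1, hp, mul_div_cancel_left₀ _ hp1]

end
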